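/- Let T be a spanning tree of a finite connected weighted graph G rooted at r, and let e1 and e2 be independent tree edges (Subtree(e1) and Subtree(e2) are disjoint). Then F_{e1} ∩ F_{e2} equals the set of edges {x, y} of G with one endpoint in Subtree(e1) and the other endpoint in Subtree(e2). -/

import Mathlib

open SimpleGraph

/-- The crossing edges of the cut `S`: edges of `G` with exactly one endpoint in `S`. -/
def crossEdges {V : Type*} (G : SimpleGraph V) (S : Set V) : Set (Sym2 V) :=
  {f | f ∈ G.edgeSet ∧ ∃ x y, f = s(x, y) ∧ x ∈ S ∧ y ∉ S}

/-- The total weight of a set of edges. -/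
noncomputable def wSet {V : Type*} (w : Sym2 V → ℝ) (F : Set (Sym2 V)) : ℝ :=
  ∑ᶠ f ∈ F, w f

/-- The weight of the cut `S`. -/
noncomputable def cutWeight {V : Type*} (G : SimpleGraph V) (w : Sym2 V → ℝ) (S : Set V) : ℝ :=
  wSet w (crossEdges G S)

/-- The minimum cut weight of `G`: the minimum of `cutWeight` over all `S` with `∅ ⊊ S ⊊ V`. -/
noncomputable def minCut {V : Type*} (G : SimpleGraph V) (w : Sym2 V → ℝ) : ℝ :=
  sInf (cutWeight G w '' {S : Set V | S.Nonempty ∧ S ≠ Set.univ})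

/-- `F_e`: the set of edges `{x, y}` of `G` (tree and non-tree) whose unique path in `T`
between `x` and `y` contains the tree edge `e`. -/
def Fe {V : Type*} (G T : SimpleGraph V) (e : Sym2 V) : Set (Sym2 V) :=
  {f | f ∈ G.edgeSet ∧ ∃ x y, f = s(x, y) ∧ ∃ p : T.Walk x y, p.IsPath ∧ e ∈ p.edges}

/-- `Subtree(e)`: the vertices whose unique path in `T` to the root `r` passes through the
tree edge `e`; equivalently, the vertex set of the subtree of `T` rooted at the endpoint of
`e` farther from `r`. -/
def subtree {V : Type*} (T : SimpleGraph V) (r : V) (e : Sym2 V) : Set V :=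
  {x | ∃ p : T.Walk x r, p.IsPath ∧ e ∈ p.edges}

/-- The unique tree path from `x` to `y` contains `e` iff deleting `e` separates them. -/
theorem path_mem_iff {V : Type*} {T : SimpleGraph V} (hT : T.IsTree) (e : Sym2 V) (x y : V) :
    (∃ p : T.Walk x y, p.IsPath ∧ e ∈ p.edges) ↔ ¬ (T.deleteEdges {e}).Reachable x y := by
  classical
  constructor
  · rintro ⟨p, hp, he⟩ ⟨q⟩
    have hle : T.deleteEdges {e} ≤ T := T.deleteEdges_le {e}
    have hq : (q.toPath.1.mapLe hle).IsPath := q.toPath.2.mapLe hle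
    have heq : p = q.toPath.1.mapLe hle := hT.existsUnique_path x y |>.unique hp hq
    rw [heq, Walk.edges_mapLe_eq_edges] at he
    have := Walk.edges_subset_edgeSet _ he
    simp [edgeSet_deleteEdges] at this
  · intro h
    obtain ⟨p, hp, -⟩ := hT.existsUnique_path x y
    refine ⟨p, hp, ?_⟩
    by_contra he
    exact h ⟨p.toDeleteEdge e he⟩

/-- Deleting an edge `ab` leaves at most two components. -/
theorem reach_or {V : Type*} {T : SimpleGraph V} (a b : V) {x z : V} (p : T.Walk x z) :
    (T.deleteEdges {s(a, b)}).Reachable x z ∨ (T.deleteEdges {s(a, b)}).Reachable x a ∨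
      (T.deleteEdges {s(a, b)}).Reachable x b := by
  induction p with
  | nil => exact Or.inl (Reachable.refl _)
  | @cons u v w h p ih =>
    by_cases he : s(u, v) = s(a, b)
    · rw [Sym2.eq_iff] at he
      rcases he with ⟨rfl, rfl⟩ | ⟨rfl, rfl⟩
      · exact Or.inr (Or.inl (Reachable.refl _))
      · exact Or.inr (Or.inr (Reachable.refl _))
    · have hr : (T.deleteEdges {s(a, b)}).Reachable u v := by
        apply Adj.reachable
        rw [deleteEdges_adj]
        exact ⟨h, he⟩
      exact ih.imp hr.trans (Or.imp hr.trans hr.trans)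

theorem two_classes {V : Type*} {T : SimpleGraph V} (hT : T.IsTree) (e : Sym2 V) (x y r : V)
    (hx : ¬ (T.deleteEdges {e}).Reachable x r) (hy : ¬ (T.deleteEdges {e}).Reachable y r) :
    (T.deleteEdges {e}).Reachable x y := by
  induction e with
  | _ a b =>
    have key : ∀ u, (T.deleteEdges {s(a, b)}).Reachable u a ∨
        (T.deleteEdges {s(a, b)}).Reachable u b := by
      intro u
      obtain ⟨p⟩ := hT.connected.preconnected u a
      have := reach_or a b p
      tauto
    rcases key x with h1 | h1 <;> rcases key y with h2 | h2 <;> rcases key r with h3 | h3 <;>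
    first
    | exact h1.trans h2.symm
    | exact absurd (h1.trans h3.symm) hx
    | exact absurd (h2.trans h3.symm) hy

theorem Fe_iff {V : Type*} {G T : SimpleGraph V} (hT : T.IsTree) (r : V) (e : Sym2 V) (x y : V) :
    s(x, y) ∈ Fe G T e ↔ s(x, y) ∈ G.edgeSet ∧
      ((x ∈ subtree T r e ∧ y ∉ subtree T r e) ∨ (x ∉ subtree T r e ∧ y ∈ subtree T r e)) := by
  have h1 : s(x, y) ∈ Fe G T e ↔
      s(x, y) ∈ G.edgeSet ∧ ¬ (T.deleteEdges {e}).Reachable x y := by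
    simp only [Fe, Set.mem_setOf_eq, path_mem_iff hT]
    refine and_congr_right fun _ => ⟨?_, fun h => ⟨x, y, rfl, h⟩⟩
    rintro ⟨u, v, huv, h⟩
    rw [Sym2.eq_iff] at huv
    rcases huv with ⟨rfl, rfl⟩ | ⟨rfl, rfl⟩
    · exact h
    · exact fun h' => h h'.symm
  rw [h1]
  simp only [subtree, Set.mem_setOf_eq, path_mem_iff hT, not_not]
  refine and_congr_right fun _ => ⟨fun h => ?_, ?_⟩
  · by_cases hx : (T.deleteEdges {e}).Reachable x r
    · exact Or.inr ⟨hx, fun hy => h (hx.trans hy.symm)⟩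
    · refine Or.inl ⟨hx, ?_⟩
      by_contra hy
      exact h (two_classes hT e x y r hx hy)
  · rintro (⟨hx, hy⟩ | ⟨hx, hy⟩) h
    · exact hx (h.trans hy)
    · exact hy (h.symm.trans hx)

theorem stmt8 {V : Type*} [Fintype V] (G T : SimpleGraph V) (w : Sym2 V → ℝ)
    (hw : ∀ f, 0 ≤ w f) (hG : G.Connected) (hTG : T ≤ G) (hT : T.IsTree)
    (r : V) (e1 e2 : Sym2 V) (he1 : e1 ∈ T.edgeSet) (he2 : e2 ∈ T.edgeSet)
    (hindep : Disjoint (subtree T r e1) (subtree T r e2)) :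
    Fe G T e1 ∩ Fe G T e2 =
      {f | f ∈ G.edgeSet ∧ ∃ x y : V, f = s(x, y) ∧
        x ∈ subtree T r e1 ∧ y ∈ subtree T r e2} := by
  have hd : ∀ v, v ∈ subtree T r e1 → v ∉ subtree T r e2 :=
    fun v h1 h2 => Set.disjoint_left.mp hindep h1 h2
  ext f
  induction f with
  | _ x y =>
    rw [Set.mem_inter_iff, Fe_iff hT r, Fe_iff hT r, Set.mem_setOf_eq]
    have hx := hd x
    have hy := hd y
    constructor
    · rintro ⟨⟨hf, h1⟩, -, h2⟩
      refine ⟨hf, ?_⟩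
      rcases h1 with ⟨h1, h1'⟩ | ⟨h1', h1⟩
      · exact ⟨x, y, rfl, h1, by tauto⟩
      · exact ⟨y, x, Sym2.eq_swap, h1, by tauto⟩
    · rintro ⟨hf, u, v, huv, hu, hv⟩
      rw [Sym2.eq_iff] at huv
      rcases huv with ⟨rfl, rfl⟩ | ⟨rfl, rfl⟩ <;> tauto
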